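/- Let γ ∈ ℝ with γ ≠ 0 and |γ| ≠ 1, and let s ≥ 1/2. Then there exists a constant C > 0 (depending on γ and s) such that for all nonnegative functions f, g, h ∈ L²(ℝ×ℤ): Σ_{n,n₁∈ℤ} ∫_{ℝ²} [ ⟨n⟩^{s} h(τ,n) f(τ₁,n₁) g(τ−τ₁, n−n₁) ] / [ ⟨τ+n²⟩^{3/8} ⟨n₁⟩^{s−1/2} ⟨τ₁+γ|n₁|n₁⟩^{1/2} ⟨n−n₁⟩^{s} ⟨τ−τ₁+(n−n₁)²⟩^{1/2} ] dτ dτ₁ ≤ C ‖f‖_{L²(ℝ×ℤ)} ‖g‖_{L²(ℝ×ℤ)} ‖h‖_{L²(ℝ×ℤ)}. (This is the dual formulation of the periodic bilinear estimate ‖uv‖_{X_{per}^{s,−3/8}} ≲ ‖u‖_{Y_{γ,per}^{s−1/2,1/2}} ‖v‖_{X_{per}^{s,1/2}}.) -/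

import Mathlib

open MeasureTheory ENNReal

/-- Japanese bracket `⟨x⟩ = 1 + |x|`. -/
noncomputable def jb (x : ℝ) : ℝ := 1 + |x|

/-- The `L²(ℝ×ℤ)` norm (valued in `ℝ≥0∞`) of a nonnegative function,
with respect to the product of Lebesgue measure on `ℝ` and counting measure on `ℤ`. -/
noncomputable def l2RZ (f : ℝ × ℤ → ℝ) : ℝ≥0∞ :=
  (∑' n : ℤ, ∫⁻ τ : ℝ, ENNReal.ofReal (f (τ, n)) ^ 2) ^ (1/2 : ℝ)


theorem jb_one_le (x : ℝ) : 1 ≤ jb x := by unfold jb; linarith [abs_nonneg x]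
theorem jb_pos (x : ℝ) : 0 < jb x := by linarith [jb_one_le x]
theorem jb_neg (x : ℝ) : jb (-x) = jb x := by simp [jb]
theorem jb_add_le (x y : ℝ) : jb (x + y) ≤ jb x * jb y := by
  unfold jb; nlinarith [abs_add_le x y, mul_nonneg (abs_nonneg x) (abs_nonneg y)]
theorem jb_measurable : Measurable jb := by unfold jb; fun_prop

theorem jb_two_max (x y a : ℝ) (h : a = x - y) : jb a ≤ 2 * max (jb x) (jb y) := by
  subst h
  have := abs_sub x y
  have h1 := le_max_left (jb x) (jb y)
  have h2 := le_max_right (jb x) (jb y)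
  unfold jb at *; linarith

/-- pointwise kernel bound -/
theorem ptw_aux {u v a : ℝ} (hu : 1 ≤ u) (hv : 1 ≤ v) (ha : 1 ≤ a) (h : a ≤ 2 * max u v) :
    u ^ (-(3/4) : ℝ) * v ^ (-1 : ℝ) ≤
      2 * a ^ (-(5/8) : ℝ) * (u ^ (-(9/8) : ℝ) + v ^ (-(9/8) : ℝ)) := by
  have hu0 : 0 < u := by linarith
  have hv0 : 0 < v := by linarith
  have ha0 : 0 < a := by linarith
  have key : ∀ w : ℝ, 0 < w → a ≤ 2 * w → w ^ (-(5/8) : ℝ) ≤ 2 * a ^ (-(5/8) : ℝ) := by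
    intro w hw haw
    have h1 : (2 * w) ^ (-(5/8) : ℝ) ≤ a ^ (-(5/8) : ℝ) :=
      Real.rpow_le_rpow_of_nonpos ha0 haw (by norm_num)
    rw [Real.mul_rpow (by norm_num) hw.le] at h1
    have h2 : (2:ℝ) ^ (-1:ℝ) ≤ (2:ℝ) ^ (-(5/8) : ℝ) :=
      Real.rpow_le_rpow_of_exponent_le (by norm_num) (by norm_num)
    rw [Real.rpow_neg_one] at h2
    have h3 : 0 < w ^ (-(5/8) : ℝ) := by positivity
    nlinarith
  rcases le_total u v with huv | huv
  · rw [max_eq_right huv] at h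
    have hk := key v hv0 h
    have e1 : v ^ (-1 : ℝ) = v ^ (-(5/8) : ℝ) * v ^ (-(3/8) : ℝ) := by
      rw [← Real.rpow_add hv0]; norm_num
    have e2 : u ^ (-(9/8) : ℝ) = u ^ (-(3/4) : ℝ) * u ^ (-(3/8) : ℝ) := by
      rw [← Real.rpow_add hu0]; norm_num
    have h4 : v ^ (-(3/8) : ℝ) ≤ u ^ (-(3/8) : ℝ) :=
      Real.rpow_le_rpow_of_nonpos hu0 huv (by norm_num)
    calc u ^ (-(3/4) : ℝ) * v ^ (-1 : ℝ)
        = u ^ (-(3/4) : ℝ) * (v ^ (-(5/8) : ℝ) * v ^ (-(3/8) : ℝ)) := by rw [e1]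
      _ ≤ u ^ (-(3/4) : ℝ) * ((2 * a ^ (-(5/8) : ℝ)) * u ^ (-(3/8) : ℝ)) := by gcongr
      _ = 2 * a ^ (-(5/8) : ℝ) * (u ^ (-(9/8) : ℝ) + 0) := by rw [e2]; ring
      _ ≤ _ := by gcongr; positivity
  · rw [max_eq_left huv] at h
    have hk := key u hu0 h
    have e1 : u ^ (-(3/4) : ℝ) = u ^ (-(5/8) : ℝ) * u ^ (-(1/8) : ℝ) := by
      rw [← Real.rpow_add hu0]; norm_num
    have e2 : v ^ (-(9/8) : ℝ) = v ^ (-1 : ℝ) * v ^ (-(1/8) : ℝ) := by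
      rw [← Real.rpow_add hv0]; norm_num
    have h4 : u ^ (-(1/8) : ℝ) ≤ v ^ (-(1/8) : ℝ) :=
      Real.rpow_le_rpow_of_nonpos hv0 huv (by norm_num)
    calc u ^ (-(3/4) : ℝ) * v ^ (-1 : ℝ)
        = (u ^ (-(5/8) : ℝ) * u ^ (-(1/8) : ℝ)) * v ^ (-1 : ℝ) := by rw [e1]
      _ ≤ ((2 * a ^ (-(5/8) : ℝ)) * v ^ (-(1/8) : ℝ)) * v ^ (-1 : ℝ) := by gcongr
      _ = 2 * a ^ (-(5/8) : ℝ) * (0 + v ^ (-(9/8) : ℝ)) := by rw [e2]; ring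
      _ ≤ _ := by gcongr; positivity

theorem int_lemma : ∃ M : ℝ≥0∞, M ≠ ⊤ ∧ ∀ a b : ℝ,
    ∫⁻ x : ℝ, ENNReal.ofReal (jb (x + a) ^ (-(3/4) : ℝ) * jb (x + b) ^ (-1 : ℝ)) ≤
      M * ENNReal.ofReal (jb (a - b) ^ (-(5/8) : ℝ)) := by
  set I := ∫⁻ x : ℝ, ENNReal.ofReal (jb x ^ (-(9/8) : ℝ)) with hI
  have hIf : I < ⊤ := by
    have := finite_integral_one_add_norm (E := ℝ) (μ := volume) (r := 9/8) (by norm_num)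
    simpa [hI, jb] using this
  refine ⟨2 * (I + I), by finiteness, fun a b => ?_⟩
  have hm := jb_measurable
  calc ∫⁻ x : ℝ, ENNReal.ofReal (jb (x + a) ^ (-(3/4) : ℝ) * jb (x + b) ^ (-1 : ℝ))
      ≤ ∫⁻ x : ℝ, ENNReal.ofReal (2 * jb (a - b) ^ (-(5/8) : ℝ)) *
          (ENNReal.ofReal (jb (x + a) ^ (-(9/8) : ℝ)) + ENNReal.ofReal (jb (x + b) ^ (-(9/8) : ℝ))) := by
        refine lintegral_mono fun x => ?_
        have p1 := jb_pos (a - b)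
        have p2 := jb_pos (x + a)
        have p3 := jb_pos (x + b)
        rw [← ENNReal.ofReal_add (by positivity) (by positivity),
          ← ENNReal.ofReal_mul (by positivity)]
        exact ENNReal.ofReal_le_ofReal (ptw_aux (jb_one_le _) (jb_one_le _) (jb_one_le _)
          (jb_two_max _ _ _ (by ring)))
    _ = ENNReal.ofReal (2 * jb (a - b) ^ (-(5/8) : ℝ)) * (I + I) := by
        rw [lintegral_const_mul _ (by fun_prop), lintegral_add_left (by fun_prop),
          lintegral_add_right_eq_self (fun x => ENNReal.ofReal (jb x ^ (-(9/8) : ℝ))) a,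
          lintegral_add_right_eq_self (fun x => ENNReal.ofReal (jb x ^ (-(9/8) : ℝ))) b]
    _ = _ := by
        rw [ENNReal.ofReal_mul (by norm_num)]
        simp only [ENNReal.ofReal_ofNat]; ring

theorem sum_aux (r : ℝ) (hr : 1 < r) : ∑' k : ℤ, ENNReal.ofReal (jb (k : ℝ) ^ (-r)) ≠ ⊤ := by
  have hs : Summable fun k : ℤ => jb (k : ℝ) ^ (-r) := by
    have h0 : Summable fun k : ℤ => |(k : ℝ)| ^ (-r) := Real.summable_abs_int_rpow hr
    refine Summable.of_norm_bounded_eventually h0 ?_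
    rw [Filter.eventually_cofinite]
    refine (Set.finite_singleton (0 : ℤ)).subset fun k hk => ?_
    by_contra hne
    apply hk
    have hk0 : (k : ℝ) ≠ 0 := by simpa using hne
    have := jb_pos (k : ℝ)
    rw [Real.norm_of_nonneg (by positivity)]
    exact Real.rpow_le_rpow_of_nonpos (by positivity) (by unfold jb; linarith) (by linarith)
  exact hs.tsum_ofReal_ne_top

theorem quad_ptw (a b c : ℝ) (ha : a ≠ 0) : ∃ y z : ℝ, ∀ x : ℝ,
    jb (a * (x - y) ^ 2) ≤ jb (a * x ^ 2 + b * x + c) ∨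
    jb (a * (x - z) ^ 2) ≤ jb (a * x ^ 2 + b * x + c) := by
  set x0 := - b / (2 * a) with hx0
  set d := x0 ^ 2 - c / a with hd
  have e : ∀ x : ℝ, a * x ^ 2 + b * x + c = a * ((x - x0) ^ 2 - d) := by
    intro x; rw [hd, hx0]; field_simp; ring
  rcases le_total d 0 with h | h
  · refine ⟨x0, x0, fun x => Or.inl ?_⟩
    rw [e]; unfold jb; rw [abs_mul, abs_mul]
    have : |(x - x0) ^ 2| ≤ |(x - x0) ^ 2 - d| := by
      rw [abs_of_nonneg (by positivity), abs_of_nonneg (by nlinarith [sq_nonneg (x - x0)])]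
      linarith
    gcongr
  · obtain ⟨t, ht, htd⟩ : ∃ t : ℝ, 0 ≤ t ∧ d = t ^ 2 := ⟨√d, Real.sqrt_nonneg _, (Real.sq_sqrt h).symm⟩
    refine ⟨x0 + t, x0 - t, fun x => ?_⟩
    rw [e]; unfold jb; rw [abs_mul, abs_mul, abs_mul]
    have e2 : (x - x0) ^ 2 - d = (x - (x0 + t)) * (x - (x0 - t)) := by rw [htd]; ring
    rw [e2, abs_mul, abs_pow, abs_pow]
    rcases le_total |x - (x0 + t)| |x - (x0 - t)| with h | h
    · left; gcongr; rw [sq]; gcongr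
    · right; gcongr; rw [sq]; gcongr

theorem shift_sum (a : ℝ) (ha : a ≠ 0) : ∃ M : ℝ≥0∞, M ≠ ⊤ ∧ ∀ y : ℝ,
    ∑' n : ℤ, ENNReal.ofReal (jb (a * ((n : ℝ) - y) ^ 2) ^ (-(5/8) : ℝ)) ≤ M := by
  set a' := min 1 |a| with ha'
  have hapos : 0 < a' := lt_min one_pos (abs_pos.mpr ha)
  have ha1 : a' ≤ 1 := min_le_left _ _
  have ha2 : a' ≤ |a| := min_le_right _ _
  set S := ∑' k : ℤ, ENNReal.ofReal (jb (k : ℝ) ^ (-(5/4) : ℝ)) with hS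
  have hSf : S ≠ ⊤ := sum_aux (5/4) (by norm_num)
  set D := (a' / 8) ^ (-(5/8) : ℝ) with hD
  have hDp : 0 < D := by positivity
  refine ⟨ENNReal.ofReal D * S, by finiteness, fun y => ?_⟩
  rw [hS, ← (Equiv.subRight ⌊y⌋).tsum_eq
    (fun k : ℤ => ENNReal.ofReal (jb (k : ℝ) ^ (-(5/4) : ℝ))), ← ENNReal.tsum_mul_left]
  refine ENNReal.tsum_le_tsum fun n => ?_
  rw [← ENNReal.ofReal_mul hDp.le]
  refine ENNReal.ofReal_le_ofReal ?_
  simp only [Equiv.subRight_apply]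
  set k := jb ((n - ⌊y⌋ : ℤ) : ℝ) with hk
  have hkp : 0 < k := jb_pos _
  have h1 : k ≤ jb ((n : ℝ) - y) * 2 := by
    have : ((n - ⌊y⌋ : ℤ) : ℝ) = ((n : ℝ) - y) + Int.fract y := by
      rw [← Int.self_sub_floor]; push_cast; ring
    rw [hk, this]
    refine (jb_add_le _ _).trans ?_
    have := jb_pos ((n : ℝ) - y)
    gcongr
    unfold jb
    rw [abs_of_nonneg (Int.fract_nonneg y)]; linarith [Int.fract_lt_one y]
  have h2 : a' / 8 * k ^ 2 ≤ jb (a * ((n : ℝ) - y) ^ 2) := by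
    unfold jb at h1 ⊢
    rw [abs_mul, abs_pow]
    set u := |(n : ℝ) - y|
    have hu : 0 ≤ u := abs_nonneg _
    have h3 : k ^ 2 ≤ ((1 + u) * 2) ^ 2 := by gcongr
    have h4 : k ^ 2 ≤ 8 * (1 + u ^ 2) := by nlinarith [sq_nonneg (1 - u)]
    nlinarith [mul_le_mul_of_nonneg_left h4 hapos.le, mul_le_mul_of_nonneg_right ha2 (sq_nonneg u)]
  calc jb (a * ((n : ℝ) - y) ^ 2) ^ (-(5/8) : ℝ) ≤ (a' / 8 * k ^ 2) ^ (-(5/8) : ℝ) :=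
        Real.rpow_le_rpow_of_nonpos (by positivity) h2 (by norm_num)
    _ = D * k ^ (-(5/4) : ℝ) := by
        rw [Real.mul_rpow (by positivity) (by positivity), ← Real.rpow_natCast, ← Real.rpow_mul hkp.le]
        norm_num [hD]

theorem quad_sum (a : ℝ) (ha : a ≠ 0) : ∃ M : ℝ≥0∞, M ≠ ⊤ ∧ ∀ b c : ℝ,
    ∑' n : ℤ, ENNReal.ofReal (jb (a * (n : ℝ) ^ 2 + b * n + c) ^ (-(5/8) : ℝ)) ≤ M := by
  obtain ⟨M, hM, h⟩ := shift_sum a ha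
  refine ⟨M + M, by finiteness, fun b c => ?_⟩
  obtain ⟨y, z, hyz⟩ := quad_ptw a b c ha
  refine le_trans ?_ (add_le_add (h y) (h z))
  rw [← ENNReal.tsum_add]
  refine ENNReal.tsum_le_tsum fun n => ?_
  rcases hyz n with h | h
  · refine le_trans (ENNReal.ofReal_le_ofReal ?_) le_self_add
    exact Real.rpow_le_rpow_of_nonpos (jb_pos _) h (by norm_num)
  · refine le_trans (ENNReal.ofReal_le_ofReal ?_) le_add_self
    exact Real.rpow_le_rpow_of_nonpos (jb_pos _) h (by norm_num)

theorem quad_sum_abs (γ : ℝ) (hγ1 : |γ| ≠ 1) : ∃ M : ℝ≥0∞, M ≠ ⊤ ∧ ∀ b c : ℝ,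
    ∑' n : ℤ, ENNReal.ofReal
      (jb ((n : ℝ) ^ 2 + γ * |(n : ℝ)| * n + b * n + c) ^ (-(5/8) : ℝ)) ≤ M := by
  have h1 : 1 + γ ≠ 0 := fun h => hγ1 (by
    have : γ = -1 := by linarith
    rw [this]; norm_num)
  have h2 : 1 - γ ≠ 0 := fun h => hγ1 (by
    have : γ = 1 := by linarith
    rw [this]; norm_num)
  obtain ⟨M, hM, h⟩ := quad_sum _ h1
  obtain ⟨M', hM', h'⟩ := quad_sum _ h2
  refine ⟨M + M', by finiteness, fun b c => ?_⟩
  refine le_trans ?_ (add_le_add (h b c) (h' b c))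
  rw [← ENNReal.tsum_add]
  refine ENNReal.tsum_le_tsum fun n => ?_
  rcases le_total 0 (n : ℝ) with hn | hn
  · refine le_trans (le_of_eq ?_) le_self_add
    rw [abs_of_nonneg hn]; ring_nf
  · refine le_trans (le_of_eq ?_) le_add_self
    rw [abs_of_nonpos hn]; ring_nf

/-- The resonance trichotomy -/
theorem resonance (γ : ℝ) (hγ1 : |γ| ≠ 1) : ∃ D : ℝ, 0 < D ∧ ∀ (n k : ℤ) (x y : ℝ),
    jb n ≤ D * jb ((n : ℝ) - k) * jb (x + (n : ℝ) ^ 2) ^ (3/4 : ℝ) ∨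
    jb n ≤ D * jb ((n : ℝ) - k) * jb (x - y + ((n : ℝ) - k) ^ 2) ∨
    jb n * jb ((n : ℝ) - k) ≤ D * jb (y + γ * |(k : ℝ)| * k) := by
  have h1 : 1 + γ ≠ 0 := fun h => hγ1 (by
    have : γ = -1 := by linarith
    rw [this]; norm_num)
  have h2 : 1 - γ ≠ 0 := fun h => hγ1 (by
    have : γ = 1 := by linarith
    rw [this]; norm_num)
  obtain ⟨c, hc0, hc1, hca, hcb⟩ : ∃ c : ℝ, 0 < c ∧ c ≤ 1 ∧ c ≤ |1 + γ| ∧ c ≤ |1 - γ| :=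
    ⟨min 1 (min |1 + γ| |1 - γ|), by positivity, min_le_left _ _,
      (min_le_right _ _).trans (min_le_left _ _), (min_le_right _ _).trans (min_le_right _ _)⟩
  refine ⟨48 / c, by positivity, fun n k x y => ?_⟩
  obtain ⟨m, hm⟩ : ∃ m : ℝ, m = (n : ℝ) - k := ⟨_, rfl⟩
  have hn : (n : ℝ) = m + k := by linarith
  rw [← hm]
  have hnm : jb n ≤ jb m + |(k : ℝ)| := by
    rw [hn]; unfold jb; linarith [abs_add_le m (k : ℝ)]
  have hcinv : 48 ≤ 48 / c := by rw [le_div_iff₀ hc0]; nlinarith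
  have hH := jb_one_le (x + (n : ℝ) ^ 2)
  have hm1 := jb_one_le m
  have hmp := jb_pos m
  by_cases hcase : c / 4 * |(k : ℝ)| ≤ |m|
  · left
    have hk : |(k : ℝ)| ≤ 4 / c * |m| := by
      rw [div_mul_eq_mul_div, le_div_iff₀ hc0]; linarith
    have : 1 ≤ jb (x + (n : ℝ) ^ 2) ^ (3/4 : ℝ) := Real.one_le_rpow hH (by norm_num)
    calc jb n ≤ jb m + 4 / c * jb m := by
          refine hnm.trans ?_
          gcongr
          refine hk.trans ?_
          unfold jb; gcongr; linarith
      _ ≤ 48 / c * jb m * 1 := by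
          have : 4 / c = (48 / c) / 12 := by ring
          rw [this]; nlinarith
      _ ≤ _ := by gcongr
  · push Not at hcase
    have hk0 : (k : ℝ) ≠ 0 := by
      intro h0; rw [h0] at hcase; simp at hcase; linarith [abs_nonneg m]
    have hk1 : 1 ≤ |(k : ℝ)| := by
      have : k ≠ 0 := by exact_mod_cast hk0
      exact_mod_cast Int.one_le_abs this
    have hmk : |m| ≤ |(k : ℝ)| := by nlinarith
    set K := |(k : ℝ)| with hK
    have hres : c / 2 * K ^ 2 ≤ |k * (2 * m + k) - γ * K * k| := by
      have e : |k * (2 * m + k) - γ * K * k| = K * |(k - γ * K) + 2 * m| := by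
        rw [hK, ← abs_mul]; congr 1; ring
      have h3 : c * K ≤ |(k:ℝ) - γ * K| := by
        rcases le_total 0 (k : ℝ) with h | h
        · have : (k:ℝ) - γ * K = (1 - γ) * k := by rw [hK, abs_of_nonneg h]; ring
          rw [this, abs_mul]; gcongr
        · have : (k:ℝ) - γ * K = (1 + γ) * k := by rw [hK, abs_of_nonpos h]; ring
          rw [this, abs_mul]; gcongr
      have h4 : |(k:ℝ) - γ * K| - 2 * |m| ≤ |(k - γ * K) + 2 * m| := by
        have := abs_sub_abs_le_abs_sub ((k:ℝ) - γ * K) (-(2 * m))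
        rw [abs_neg, abs_mul, sub_neg_eq_add] at this
        norm_num at this; linarith
      rw [e, show c / 2 * K ^ 2 = K * (c / 2 * K) by ring]
      gcongr
      linarith
    have htri : |k * (2 * m + k) - γ * K * k| ≤
        |x + (n : ℝ) ^ 2| + |y + γ * K * k| + |x - y + m ^ 2| := by
      have e : k * (2 * m + k) - γ * K * k = (x + (n : ℝ) ^ 2) - (y + γ * K * k) - (x - y + m ^ 2) := by
        rw [hn]; ring
      rw [e]
      exact (abs_sub _ _).trans (by gcongr; exact abs_sub _ _)
    have hnk : jb n ≤ 3 * K := by unfold jb at hnm ⊢; linarith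
    have hmk2 : jb m ≤ 2 * K := by unfold jb; linarith
    have hdiv : ∀ A : ℝ, c / 6 * K ^ 2 ≤ A → 6 * K ^ 2 ≤ 48 / c * A := by
      intro A hA
      rw [div_mul_eq_mul_div, le_div_iff₀ hc0]; nlinarith [sq_nonneg K]
    have hcases : c / 6 * K ^ 2 ≤ |x + (n : ℝ) ^ 2| ∨ c / 6 * K ^ 2 ≤ |x - y + m ^ 2| ∨
        c / 6 * K ^ 2 ≤ |y + γ * K * k| := by
      by_contra! hcon
      linarith [hcon.1, hcon.2.1, hcon.2.2]
    rcases hcases with h | h | h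
    · left
      have h5 : c / 6 * K ^ 2 ≤ jb (x + (n : ℝ) ^ 2) := by unfold jb; linarith
      have h6 : c / 6 * K ≤ jb (x + (n : ℝ) ^ 2) ^ (3/4 : ℝ) := by
        refine le_trans ?_ (Real.rpow_le_rpow_of_exponent_le hH (show (1/2:ℝ) ≤ 3/4 by norm_num))
        rw [← Real.sqrt_eq_rpow]
        refine Real.le_sqrt_of_sq_le (le_trans ?_ h5)
        have : (c / 6 * K) ^ 2 = (c / 6 * K ^ 2) * (c / 6) := by ring
        rw [this]
        exact mul_le_of_le_one_right (by positivity) (by linarith)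
      have h7 : 3 * K ≤ 48 / c * jb (x + (n : ℝ) ^ 2) ^ (3/4 : ℝ) := by
        rw [div_mul_eq_mul_div, le_div_iff₀ hc0]; nlinarith
      have h8 : 0 ≤ 48 / c * jb (x + (n : ℝ) ^ 2) ^ (3/4 : ℝ) := by positivity
      nlinarith
    · right; left
      have h7 := hdiv (jb (x - y + m ^ 2)) (by unfold jb; linarith)
      have h8 : 0 ≤ 48 / c * jb (x - y + m ^ 2) := by linarith [sq_nonneg K]
      nlinarith
    · right; right
      have h7 := hdiv (jb (y + γ * K * k)) (by unfold jb; linarith)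
      have := jb_pos n
      nlinarith [mul_le_mul hnk hmk2 hmp.le (by positivity)]

/-- product measure on `ℝ × ℤ` -/
noncomputable def PP : Measure (ℝ × ℤ) := (volume : Measure ℝ).prod (Measure.count : Measure ℤ)

instance : SFinite PP := by unfold PP; infer_instance
instance : PP.IsAddLeftInvariant := by unfold PP; infer_instance
instance : PP.IsNegInvariant := by
  unfold PP
  constructor
  change Measure.map (Prod.map Neg.neg Neg.neg) _ = _
  rw [← Measure.map_prod_map _ _ measurable_neg measurable_neg]
  congr 1
  · exact Measure.map_neg_eq_self _
  · exact Measure.map_neg_eq_self _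

theorem lint_PP (f : ℝ × ℤ → ℝ≥0∞) (hf : Measurable f) :
    ∫⁻ p, f p ∂PP = ∑' n : ℤ, ∫⁻ τ : ℝ, f (τ, n) := by
  unfold PP
  rw [lintegral_prod_symm' _ hf, lintegral_count]

/-- abstract Cauchy-Schwarz -/
theorem cs1 {α : Type*} [MeasurableSpace α] (μ : Measure α) {f g : α → ℝ≥0∞}
    (hf : Measurable f) (hg : Measurable g) :
    ∫⁻ x, f x * g x ∂μ ≤ (∫⁻ x, f x ^ 2 ∂μ) ^ (1/2 : ℝ) * (∫⁻ x, g x ^ 2 ∂μ) ^ (1/2 : ℝ) := by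
  have := ENNReal.lintegral_mul_le_Lp_mul_Lq μ Real.HolderConjugate.two_two hf.aemeasurable hg.aemeasurable
  simpa using this

theorem sq_half (x : ℝ≥0∞) : (x ^ (1/2 : ℝ)) ^ 2 = x := by
  rw [← ENNReal.rpow_natCast, ← ENNReal.rpow_mul]; norm_num

theorem cs2 {A : ℝ × ℤ → ℝ≥0∞} {B K : (ℝ × ℤ) → (ℝ × ℤ) → ℝ≥0∞}
    (hA : Measurable A) (hB : Measurable (Function.uncurry B)) (hK : Measurable (Function.uncurry K))
    {M N : ℝ≥0∞} (hM : ∀ p, ∫⁻ q, K p q ^ 2 ∂PP ≤ M)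
    (hN : ∫⁻ p, ∫⁻ q, B p q ^ 2 ∂PP ∂PP ≤ N) :
    ∫⁻ p, ∫⁻ q, A p * (B p q * K p q) ∂PP ∂PP ≤
      M ^ (1/2 : ℝ) * ((∫⁻ p, A p ^ 2 ∂PP) ^ (1/2 : ℝ) * N ^ (1/2 : ℝ)) := by
  have hQ : Measurable fun p => ∫⁻ q, B p q ^ 2 ∂PP :=
    Measurable.lintegral_prod_right' (f := fun z : (ℝ × ℤ) × (ℝ × ℤ) => B z.1 z.2 ^ 2) (hB.pow_const 2)
  calc ∫⁻ p, ∫⁻ q, A p * (B p q * K p q) ∂PP ∂PP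
      ≤ ∫⁻ p, M ^ (1/2 : ℝ) * (A p * (∫⁻ q, B p q ^ 2 ∂PP) ^ (1/2 : ℝ)) ∂PP := by
        refine lintegral_mono fun p => ?_
        have hBp : Measurable (B p) := hB.comp (measurable_const.prodMk measurable_id)
        have hKp : Measurable (K p) := hK.comp (measurable_const.prodMk measurable_id)
        rw [lintegral_const_mul (A p) (by fun_prop : Measurable fun q => B p q * K p q)]
        calc A p * ∫⁻ q, B p q * K p q ∂PP
            ≤ A p * ((∫⁻ q, B p q ^ 2 ∂PP) ^ (1/2 : ℝ) * (∫⁻ q, K p q ^ 2 ∂PP) ^ (1/2 : ℝ)) := by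
              gcongr; exact cs1 _ hBp hKp
          _ ≤ A p * ((∫⁻ q, B p q ^ 2 ∂PP) ^ (1/2 : ℝ) * M ^ (1/2 : ℝ)) := by
              gcongr; exact hM p
          _ = _ := by ring
    _ = M ^ (1/2 : ℝ) * ∫⁻ p, A p * (∫⁻ q, B p q ^ 2 ∂PP) ^ (1/2 : ℝ) ∂PP :=
        lintegral_const_mul _ (hA.mul (hQ.pow_const _))
    _ ≤ M ^ (1/2 : ℝ) * ((∫⁻ p, A p ^ 2 ∂PP) ^ (1/2 : ℝ) *
          (∫⁻ p, ((∫⁻ q, B p q ^ 2 ∂PP) ^ (1/2 : ℝ)) ^ 2 ∂PP) ^ (1/2 : ℝ)) := by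
        gcongr; exact cs1 _ hA (hQ.pow_const _)
    _ ≤ _ := by
        simp only [sq_half]
        gcongr

section three
variable {f g h : ℝ × ℤ → ℝ≥0∞} {K : (ℝ × ℤ) → (ℝ × ℤ) → ℝ≥0∞} {M : ℝ≥0∞}

theorem tri1 (hf : Measurable f) (hg : Measurable g) (hh : Measurable h)
    (hK : Measurable (Function.uncurry K)) (hM : ∀ p, ∫⁻ q, K p q ^ 2 ∂PP ≤ M) :
    ∫⁻ p, ∫⁻ q, h p * f q * g (p - q) * K p q ∂PP ∂PP ≤
      M ^ (1/2 : ℝ) * ((∫⁻ p, f p ^ 2 ∂PP) ^ (1/2 : ℝ) * (∫⁻ p, g p ^ 2 ∂PP) ^ (1/2 : ℝ)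
        * (∫⁻ p, h p ^ 2 ∂PP) ^ (1/2 : ℝ)) := by
  have := cs2 (A := h) (B := fun p q => f q * g (p - q)) (K := K) hh
    ((hf.comp measurable_snd).mul (hg.comp (measurable_fst.sub measurable_snd))) hK hM
    (N := (∫⁻ p, f p ^ 2 ∂PP) * (∫⁻ p, g p ^ 2 ∂PP)) (by
      rw [lintegral_lintegral_swap (((hf.comp measurable_snd).mul
        (hg.comp (measurable_fst.sub measurable_snd))).pow_const 2).aemeasurable]
      rw [← lintegral_mul_const _ (hf.pow_const 2)]
      refine lintegral_mono fun q => ?_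
      simp only [mul_pow]
      rw [lintegral_const_mul _ (by fun_prop)]
      rw [lintegral_sub_right_eq_self (fun p => g p ^ 2) q])
  rw [ENNReal.mul_rpow_of_nonneg _ _ (by norm_num)] at this
  refine le_trans (le_of_eq ?_) (this.trans (le_of_eq ?_))
  · refine lintegral_congr fun p => lintegral_congr fun q => ?_
    ring
  · ring

theorem tri3 (hf : Measurable f) (hg : Measurable g) (hh : Measurable h)
    (hK : Measurable (Function.uncurry K)) (hM : ∀ q, ∫⁻ p, K p q ^ 2 ∂PP ≤ M) :
    ∫⁻ p, ∫⁻ q, h p * f q * g (p - q) * K p q ∂PP ∂PP ≤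
      M ^ (1/2 : ℝ) * ((∫⁻ p, f p ^ 2 ∂PP) ^ (1/2 : ℝ) * (∫⁻ p, g p ^ 2 ∂PP) ^ (1/2 : ℝ)
        * (∫⁻ p, h p ^ 2 ∂PP) ^ (1/2 : ℝ)) := by
  have := cs2 (A := f) (B := fun q p => h p * g (p - q)) (K := fun q p => K p q) hf
    ((hh.comp measurable_snd).mul (hg.comp (measurable_snd.sub measurable_fst)))
    (hK.comp measurable_swap) hM
    (N := (∫⁻ p, h p ^ 2 ∂PP) * (∫⁻ p, g p ^ 2 ∂PP)) (by
      rw [lintegral_lintegral_swap (((hh.comp measurable_snd).mul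
        (hg.comp (measurable_snd.sub measurable_fst))).pow_const 2).aemeasurable]
      rw [← lintegral_mul_const _ (hh.pow_const 2)]
      refine lintegral_mono fun q => ?_
      simp only [mul_pow]
      rw [lintegral_const_mul _ (by fun_prop)]
      rw [lintegral_sub_left_eq_self (fun p => g p ^ 2) q])
  rw [ENNReal.mul_rpow_of_nonneg _ _ (by norm_num)] at this
  refine le_trans (le_of_eq ?_) (this.trans (le_of_eq ?_))
  · rw [lintegral_lintegral_swap]
    · refine lintegral_congr fun p => lintegral_congr fun q => ?_
      ring
    · exact (Measurable.mul (((hh.comp measurable_fst).mul (hf.comp measurable_snd)).mul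
        (hg.comp (measurable_fst.sub measurable_snd))) hK).aemeasurable
  · ring

theorem tri2 (hf : Measurable f) (hg : Measurable g) (hh : Measurable h)
    (hK : Measurable (Function.uncurry K)) (hM : ∀ r, ∫⁻ q, K (r + q) q ^ 2 ∂PP ≤ M) :
    ∫⁻ p, ∫⁻ q, h p * f q * g (p - q) * K p q ∂PP ∂PP ≤
      M ^ (1/2 : ℝ) * ((∫⁻ p, f p ^ 2 ∂PP) ^ (1/2 : ℝ) * (∫⁻ p, g p ^ 2 ∂PP) ^ (1/2 : ℝ)
        * (∫⁻ p, h p ^ 2 ∂PP) ^ (1/2 : ℝ)) := by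
  have hK' : Measurable (fun z : (ℝ × ℤ) × (ℝ × ℤ) => K (z.1 + z.2) z.2) :=
    hK.comp ((measurable_fst.add measurable_snd).prodMk measurable_snd)
  have := cs2 (A := g) (B := fun r q => f q * h (r + q)) (K := fun r q => K (r + q) q) hg
    ((hf.comp measurable_snd).mul (hh.comp (measurable_fst.add measurable_snd)))
    hK' hM
    (N := (∫⁻ p, f p ^ 2 ∂PP) * (∫⁻ p, h p ^ 2 ∂PP)) (by
      rw [lintegral_lintegral_swap (((hf.comp measurable_snd).mul
        (hh.comp (measurable_fst.add measurable_snd))).pow_const 2).aemeasurable]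
      rw [← lintegral_mul_const _ (hf.pow_const 2)]
      refine lintegral_mono fun q => ?_
      simp only [mul_pow]
      rw [lintegral_const_mul _ (by fun_prop)]
      rw [lintegral_add_right_eq_self (fun p => h p ^ 2) q])
  rw [ENNReal.mul_rpow_of_nonneg _ _ (by norm_num)] at this
  refine le_trans (le_of_eq ?_) (this.trans (le_of_eq ?_))
  · rw [lintegral_lintegral_swap]
    · rw [lintegral_lintegral_swap (f := fun r q => g r * (f q * h (r + q) * K (r + q) q))]
      · refine lintegral_congr fun q => ?_
        rw [← lintegral_add_right_eq_self _ q]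
        refine lintegral_congr fun r => ?_
        rw [add_sub_cancel_right]
        ring
      · exact (Measurable.mul (hg.comp measurable_fst) (((hf.comp measurable_snd).mul
          (hh.comp (measurable_fst.add measurable_snd))).mul hK')).aemeasurable
    · exact (Measurable.mul (((hh.comp measurable_fst).mul (hf.comp measurable_snd)).mul
        (hg.comp (measurable_fst.sub measurable_snd))) hK).aemeasurable
  · ring
end three

theorem real_ptw {s D N k m H F G : ℝ} (hs : 1/2 ≤ s) (hD : 0 < D) (hN : 0 < N) (hk : 0 < k)
    (hm : 0 < m) (hH : 0 < H) (hF : 0 < F) (hG : 0 < G) (hNkm : N ≤ k * m)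
    (htri : N ≤ D * m * H ^ (3/4 : ℝ) ∨ N ≤ D * m * G ∨ N * m ≤ D * F) :
    N ^ s / (H ^ (3/8 : ℝ) * k ^ (s - 1/2) * F ^ (1/2 : ℝ) * m ^ s * G ^ (1/2 : ℝ)) ≤
      D ^ (1/2 : ℝ) * (F ^ (-(1/2) : ℝ) * G ^ (-(1/2) : ℝ) + H ^ (-(3/8) : ℝ) * F ^ (-(1/2) : ℝ)
        + m ^ (-1 : ℝ) * H ^ (-(3/8) : ℝ) * G ^ (-(1/2) : ℝ)) := by
  have e1 : N ^ s = N ^ (s - 1/2) * N ^ (1/2 : ℝ) := by rw [← Real.rpow_add hN]; ring_nf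
  have e2 : m ^ s = m ^ (s - 1/2) * m ^ (1/2 : ℝ) := by rw [← Real.rpow_add hm]; ring_nf
  have h1 : N ^ (s - 1/2) ≤ k ^ (s - 1/2) * m ^ (s - 1/2) := by
    rw [← Real.mul_rpow hk.le hm.le]
    exact Real.rpow_le_rpow hN.le hNkm (by linarith)
  have e3 : m ^ (-1 : ℝ) = (m ^ (1/2 : ℝ) * m ^ (1/2 : ℝ))⁻¹ := by
    rw [← Real.rpow_add hm, Real.rpow_neg hm.le]; norm_num
  have e4 : (H ^ (3/4 : ℝ)) ^ (1/2 : ℝ) = H ^ (3/8 : ℝ) := by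
    rw [← Real.rpow_mul hH.le]; norm_num
  have step : N ^ s / (H ^ (3/8 : ℝ) * k ^ (s - 1/2) * F ^ (1/2 : ℝ) * m ^ s * G ^ (1/2 : ℝ)) ≤
      N ^ (1/2 : ℝ) / (H ^ (3/8 : ℝ) * F ^ (1/2 : ℝ) * m ^ (1/2 : ℝ) * G ^ (1/2 : ℝ)) := by
    rw [div_le_div_iff₀ (by positivity) (by positivity), e1, e2]
    calc N ^ (s - 1/2) * N ^ (1/2 : ℝ) * (H ^ (3/8 : ℝ) * F ^ (1/2 : ℝ) * m ^ (1/2 : ℝ) * G ^ (1/2 : ℝ))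
        ≤ (k ^ (s - 1/2) * m ^ (s - 1/2)) * N ^ (1/2 : ℝ) *
          (H ^ (3/8 : ℝ) * F ^ (1/2 : ℝ) * m ^ (1/2 : ℝ) * G ^ (1/2 : ℝ)) := by gcongr
      _ = _ := by ring
  refine step.trans ?_
  rw [e3, Real.rpow_neg hF.le, Real.rpow_neg hG.le, Real.rpow_neg hH.le]
  have htri' : N ^ (1/2 : ℝ) ≤ D ^ (1/2 : ℝ) * m ^ (1/2 : ℝ) * H ^ (3/8 : ℝ) ∨
      N ^ (1/2 : ℝ) ≤ D ^ (1/2 : ℝ) * m ^ (1/2 : ℝ) * G ^ (1/2 : ℝ) ∨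
      N ^ (1/2 : ℝ) * m ^ (1/2 : ℝ) ≤ D ^ (1/2 : ℝ) * F ^ (1/2 : ℝ) := by
    rcases htri with h | h | h
    · left
      rw [← e4, ← Real.mul_rpow hD.le hm.le, ← Real.mul_rpow (by positivity) (by positivity)]
      exact Real.rpow_le_rpow hN.le h (by norm_num)
    · right; left
      rw [← Real.mul_rpow hD.le hm.le, ← Real.mul_rpow (by positivity) (by positivity)]
      exact Real.rpow_le_rpow hN.le h (by norm_num)
    · right; right
      rw [← Real.mul_rpow hD.le hF.le, ← Real.mul_rpow hN.le hm.le]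
      exact Real.rpow_le_rpow (by positivity) h (by norm_num)
  have pN : 0 < N ^ (1/2 : ℝ) := by positivity
  have pD : 0 < D ^ (1/2 : ℝ) := by positivity
  have pm : 0 < m ^ (1/2 : ℝ) := by positivity
  have pH : 0 < H ^ (3/8 : ℝ) := by positivity
  have pF : 0 < F ^ (1/2 : ℝ) := by positivity
  have pG : 0 < G ^ (1/2 : ℝ) := by positivity
  generalize N ^ (1/2 : ℝ) = N at *
  generalize D ^ (1/2 : ℝ) = D at *
  generalize m ^ (1/2 : ℝ) = m at *
  generalize H ^ (3/8 : ℝ) = H at *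
  generalize F ^ (1/2 : ℝ) = F at *
  generalize G ^ (1/2 : ℝ) = G at *
  have q1 : 0 ≤ F⁻¹ * G⁻¹ := by positivity
  have q2 : 0 ≤ H⁻¹ * F⁻¹ := by positivity
  have q3 : 0 ≤ (m * m)⁻¹ * H⁻¹ * G⁻¹ := by positivity
  rcases htri' with h | h | h
  · calc N / (H * F * m * G) ≤ (D * m * H) / (H * F * m * G) := by gcongr
      _ = D * (F⁻¹ * G⁻¹) := by field_simp
      _ ≤ _ := by gcongr; linarith
  · calc N / (H * F * m * G) ≤ (D * m * G) / (H * F * m * G) := by gcongr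
      _ = D * (H⁻¹ * F⁻¹) := by field_simp
      _ ≤ _ := by gcongr; linarith
  · calc N / (H * F * m * G) = (N * m) / (H * F * m * G * m) := by field_simp
      _ ≤ (D * F) / (H * F * m * G * m) := by gcongr
      _ = D * ((m * m)⁻¹ * H⁻¹ * G⁻¹) := by field_simp
      _ ≤ _ := by gcongr; linarith

noncomputable def Fw (γ : ℝ) (q : ℝ × ℤ) : ℝ := jb (q.1 + γ * |(q.2 : ℝ)| * (q.2 : ℝ))
noncomputable def Gw (q : ℝ × ℤ) : ℝ := jb (q.1 + (q.2 : ℝ) ^ 2)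
noncomputable def K1 (γ : ℝ) (p q : ℝ × ℤ) : ℝ≥0∞ :=
  ENNReal.ofReal (Fw γ q ^ (-(1/2) : ℝ) * Gw (p - q) ^ (-(1/2) : ℝ))
noncomputable def K2 (γ : ℝ) (p q : ℝ × ℤ) : ℝ≥0∞ :=
  ENNReal.ofReal (Gw p ^ (-(3/8) : ℝ) * Fw γ q ^ (-(1/2) : ℝ))
noncomputable def K3 (p q : ℝ × ℤ) : ℝ≥0∞ :=
  ENNReal.ofReal (jb ((p.2 : ℝ) - q.2) ^ (-1 : ℝ) * Gw p ^ (-(3/8) : ℝ) * Gw (p - q) ^ (-(1/2) : ℝ))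

theorem Fw_pos (γ : ℝ) (q) : 0 < Fw γ q := jb_pos _
theorem Gw_pos (q) : 0 < Gw q := jb_pos _
theorem intcast_meas : Measurable fun n : ℤ => (n : ℝ) := measurable_of_countable _

theorem Fw_meas (γ : ℝ) : Measurable (Fw γ) := by
  have h2 : Measurable fun q : ℝ × ℤ => γ * |(q.2 : ℝ)| * (q.2 : ℝ) :=
    (measurable_of_countable (fun n : ℤ => γ * |(n : ℝ)| * (n : ℝ))).comp measurable_snd
  exact jb_measurable.comp (measurable_fst.add h2)
theorem Gw_meas : Measurable Gw := by
  have h2 : Measurable fun q : ℝ × ℤ => (q.2 : ℝ) ^ 2 :=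
    (measurable_of_countable (fun n : ℤ => (n : ℝ) ^ 2)).comp measurable_snd
  exact jb_measurable.comp (measurable_fst.add h2)

theorem K1_meas (γ : ℝ) : Measurable (Function.uncurry (K1 γ)) := by
  have h1 : Measurable fun z : (ℝ × ℤ) × (ℝ × ℤ) => Fw γ z.2 := (Fw_meas γ).comp measurable_snd
  have h2 : Measurable fun z : (ℝ × ℤ) × (ℝ × ℤ) => Gw (z.1 - z.2) :=
    Gw_meas.comp (measurable_fst.sub measurable_snd)
  exact ((h1.pow_const _).mul (h2.pow_const _)).ennreal_ofReal
theorem K2_meas (γ : ℝ) : Measurable (Function.uncurry (K2 γ)) := by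
  have h1 : Measurable fun z : (ℝ × ℤ) × (ℝ × ℤ) => Fw γ z.2 := (Fw_meas γ).comp measurable_snd
  have h2 : Measurable fun z : (ℝ × ℤ) × (ℝ × ℤ) => Gw z.1 := Gw_meas.comp measurable_fst
  exact ((h2.pow_const _).mul (h1.pow_const _)).ennreal_ofReal
theorem K3_meas : Measurable (Function.uncurry K3) := by
  have h1 : Measurable fun z : (ℝ × ℤ) × (ℝ × ℤ) => Gw z.1 := Gw_meas.comp measurable_fst
  have h2 : Measurable fun z : (ℝ × ℤ) × (ℝ × ℤ) => Gw (z.1 - z.2) :=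
    Gw_meas.comp (measurable_fst.sub measurable_snd)
  have h3 : Measurable fun z : (ℝ × ℤ) × (ℝ × ℤ) => jb ((z.1.2 : ℝ) - z.2.2) := by
    refine jb_measurable.comp (Measurable.sub ?_ ?_)
    · exact intcast_meas.comp (measurable_snd.comp measurable_fst)
    · exact intcast_meas.comp (measurable_snd.comp measurable_snd)
  exact (((h3.pow_const _).mul (h1.pow_const _)).mul (h2.pow_const _)).ennreal_ofReal

theorem sq_rpow {x : ℝ} (hx : 0 < x) (a : ℝ) : (x ^ a) ^ 2 = x ^ (2 * a) := by
  rw [← Real.rpow_natCast, ← Real.rpow_mul hx.le]; congr 1; push_cast; ring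

theorem K1_bound (γ : ℝ) (hγ1 : |γ| ≠ 1) : ∃ M : ℝ≥0∞, M ≠ ⊤ ∧ ∀ p, ∫⁻ q, K1 γ p q ^ 2 ∂PP ≤ M := by
  obtain ⟨M, hM, hbd⟩ := int_lemma
  obtain ⟨S, hS, hsum⟩ := quad_sum_abs γ hγ1
  refine ⟨M * S, by finiteness, fun p => ?_⟩
  rw [lint_PP (fun q => K1 γ p q ^ 2) (((K1_meas γ).comp (measurable_const.prodMk measurable_id)).pow_const 2)]
  refine le_trans ?_ (mul_le_mul_right (hsum (-2 * p.2) (p.1 + (p.2 : ℝ) ^ 2)) M)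
  rw [← ENNReal.tsum_mul_left]
  refine ENNReal.tsum_le_tsum fun n => ?_
  refine le_trans ?_ ((hbd (-(p.1 + ((p.2 : ℝ) - n) ^ 2)) (γ * |(n : ℝ)| * n)).trans (le_of_eq ?_))
  · refine lintegral_mono fun τ => ?_
    simp only [K1]
    rw [← ENNReal.ofReal_pow (by have := Fw_pos γ (τ, n); have := Gw_pos (p - (τ, n)); positivity)]
    refine ENNReal.ofReal_le_ofReal ?_
    rw [mul_pow, sq_rpow (Fw_pos _ _), sq_rpow (Gw_pos _), mul_comm]
    have e : Gw (p - (τ, n)) = jb (τ + -(p.1 + ((p.2 : ℝ) - n) ^ 2)) := by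
      rw [← jb_neg]; unfold Gw; congr 1
      simp only [Prod.fst_sub, Prod.snd_sub, Int.cast_sub]; ring
    rw [e]
    have h1 := jb_one_le (τ + -(p.1 + ((p.2 : ℝ) - n) ^ 2))
    have h2 := Fw_pos γ (τ, n)
    have : (2 * -(1/2) : ℝ) = -1 := by norm_num
    rw [this]
    refine mul_le_mul_of_nonneg_right ?_ (by positivity)
    exact Real.rpow_le_rpow_of_exponent_le h1 (by norm_num)
  · congr 3
    rw [← jb_neg]; congr 1; ring

theorem K2_bound (γ : ℝ) (hγ1 : |γ| ≠ 1) :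
    ∃ M : ℝ≥0∞, M ≠ ⊤ ∧ ∀ r, ∫⁻ q, K2 γ (r + q) q ^ 2 ∂PP ≤ M := by
  obtain ⟨M, hM, hbd⟩ := int_lemma
  obtain ⟨S, hS, hsum⟩ := quad_sum_abs (-γ) (by rwa [abs_neg])
  refine ⟨M * S, by finiteness, fun r => ?_⟩
  rw [lint_PP (fun q => K2 γ (r + q) q ^ 2) (((K2_meas γ).comp
    ((measurable_const.add measurable_id).prodMk measurable_id)).pow_const 2)]
  refine le_trans ?_ (mul_le_mul_right (hsum (2 * r.2) (r.1 + (r.2 : ℝ) ^ 2)) M)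
  rw [← ENNReal.tsum_mul_left]
  refine ENNReal.tsum_le_tsum fun n => ?_
  refine le_trans ?_ ((hbd (r.1 + ((r.2 : ℝ) + n) ^ 2) (γ * |(n : ℝ)| * n)).trans (le_of_eq ?_))
  · refine lintegral_mono fun τ => ?_
    simp only [K2]
    rw [← ENNReal.ofReal_pow (by have := Fw_pos γ (τ, n); have := Gw_pos (r + (τ, n)); positivity)]
    refine ENNReal.ofReal_le_ofReal (le_of_eq ?_)
    rw [mul_pow, sq_rpow (Fw_pos _ _), sq_rpow (Gw_pos _)]
    have e : Gw (r + (τ, n)) = jb (τ + (r.1 + ((r.2 : ℝ) + n) ^ 2)) := by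
      unfold Gw; congr 1
      simp only [Prod.fst_add, Prod.snd_add, Int.cast_add]; ring
    rw [e]
    norm_num [Fw]
  · congr 3
    congr 1; ring

theorem K3_bound : ∃ M : ℝ≥0∞, M ≠ ⊤ ∧ ∀ q, ∫⁻ p, K3 p q ^ 2 ∂PP ≤ M := by
  obtain ⟨M, hM, hbd⟩ := int_lemma
  have hS := sum_aux 2 (by norm_num)
  set S := ∑' k : ℤ, ENNReal.ofReal (jb (k : ℝ) ^ (-2 : ℝ)) with hSdef
  refine ⟨M * S, by finiteness, fun q => ?_⟩
  rw [lint_PP (fun p => K3 p q ^ 2) ((K3_meas.comp (measurable_id.prodMk measurable_const)).pow_const 2)]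
  rw [hSdef, ← (Equiv.subRight q.2).tsum_eq
    (fun k : ℤ => ENNReal.ofReal (jb (k : ℝ) ^ (-2 : ℝ))), ← ENNReal.tsum_mul_left]
  refine ENNReal.tsum_le_tsum fun n => ?_
  simp only [Equiv.subRight_apply]
  have hbd' := hbd ((n : ℝ) ^ 2) (-q.1 + ((n : ℝ) - q.2) ^ 2)
  have h1 : jb ((n : ℝ) ^ 2 - (-q.1 + ((n : ℝ) - q.2) ^ 2)) ^ (-(5/8) : ℝ) ≤ 1 :=
    Real.rpow_le_one_of_one_le_of_nonpos (jb_one_le _) (by norm_num)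
  have hbd2 : ∫⁻ x : ℝ, ENNReal.ofReal (jb (x + (n : ℝ) ^ 2) ^ (-(3/4) : ℝ) *
      jb (x + (-q.1 + ((n : ℝ) - q.2) ^ 2)) ^ (-1 : ℝ)) ≤ M := by
    refine hbd'.trans ?_
    calc _ ≤ M * ENNReal.ofReal 1 := by gcongr
      _ = M := by simp
  rw [mul_comm]
  refine le_trans ?_ (mul_le_mul_right hbd2 _)
  rw [← lintegral_const_mul' _ _ ENNReal.ofReal_ne_top]
  refine lintegral_mono fun τ => ?_
  simp only [K3]
  have p1 := Gw_pos (τ, n)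
  have p2 := Gw_pos ((τ, n) - q)
  have p3 := jb_pos ((n : ℝ) - q.2)
  rw [← ENNReal.ofReal_pow (by positivity), ← ENNReal.ofReal_mul (by
    have := jb_pos ((n - q.2 : ℤ) : ℝ); positivity)]
  refine ENNReal.ofReal_le_ofReal (le_of_eq ?_)
  rw [mul_pow, mul_pow, sq_rpow p1, sq_rpow p2, sq_rpow p3]
  have e : Gw ((τ, n) - q) = jb (τ + (-q.1 + ((n : ℝ) - q.2) ^ 2)) := by
    unfold Gw; congr 1
    simp only [Prod.fst_sub, Prod.snd_sub, Int.cast_sub]; ring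
  rw [e, Int.cast_sub, mul_assoc]
  norm_num [Gw]

theorem l2RZ_eq (f : ℝ × ℤ → ℝ) (hf : Measurable f) :
    l2RZ f = (∫⁻ p, ENNReal.ofReal (f p) ^ 2 ∂PP) ^ (1/2 : ℝ) := by
  rw [l2RZ, lint_PP _ (by fun_prop)]

theorem unfold_sum (T : (ℝ × ℤ) → (ℝ × ℤ) → ℝ≥0∞)
    (mT : Measurable fun z : (ℝ × ℤ) × (ℝ × ℤ) => T z.1 z.2) :
    ∑' n : ℤ, ∑' n₁ : ℤ, ∫⁻ τ : ℝ, ∫⁻ τ₁ : ℝ, T (τ, n) (τ₁, n₁) = ∫⁻ p, ∫⁻ q, T p q ∂PP ∂PP := by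
  rw [lint_PP (fun p => ∫⁻ q, T p q ∂PP) mT.lintegral_prod_right']
  refine tsum_congr fun n => ?_
  rw [← lintegral_tsum]
  · refine lintegral_congr fun τ => ?_
    rw [lint_PP (fun q => T (τ, n) q) (mT.comp (measurable_const.prodMk measurable_id))]
  · intro n₁
    have : Measurable fun z : ℝ × ℝ => T (z.1, n) (z.2, n₁) :=
      mT.comp ((measurable_fst.prodMk measurable_const).prodMk
        (measurable_snd.prodMk measurable_const))
    exact this.lintegral_prod_right'.aemeasurable

theorem split_int (T U : (ℝ × ℤ) → (ℝ × ℤ) → ℝ≥0∞)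
    (mT : Measurable fun z : (ℝ × ℤ) × (ℝ × ℤ) => T z.1 z.2) :
    ∫⁻ p, ∫⁻ q, (T p q + U p q) ∂PP ∂PP =
      ∫⁻ p, ∫⁻ q, T p q ∂PP ∂PP + ∫⁻ p, ∫⁻ q, U p q ∂PP ∂PP := by
  have m0 : Measurable fun p => ∫⁻ q, T p q ∂PP := mT.lintegral_prod_right'
  rw [← lintegral_add_left m0]
  refine lintegral_congr fun p => ?_
  have m1 : Measurable fun q => T p q := mT.comp (measurable_const.prodMk measurable_id)
  rw [← lintegral_add_left m1]

/-- Dual formulation of the periodic bilinear estimate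
`‖uv‖_{X_{per}^{s,−3/8}} ≲ ‖u‖_{Y_{γ,per}^{s−1/2,1/2}} ‖v‖_{X_{per}^{s,1/2}}`. -/
theorem periodic_bilinear_estimate_X (γ s : ℝ) (hγ : γ ≠ 0) (hγ1 : |γ| ≠ 1)
    (hs : 1/2 ≤ s) :
    ∃ C : ℝ, 0 < C ∧ ∀ f g h : ℝ × ℤ → ℝ,
      Measurable f → Measurable g → Measurable h →
      (∀ p, 0 ≤ f p) → (∀ p, 0 ≤ g p) → (∀ p, 0 ≤ h p) →
      l2RZ f ≠ ⊤ → l2RZ g ≠ ⊤ → l2RZ h ≠ ⊤ →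
      (∑' n : ℤ, ∑' n₁ : ℤ, ∫⁻ τ : ℝ, ∫⁻ τ₁ : ℝ,
        ENNReal.ofReal (
          jb (n : ℝ) ^ s * h (τ, n) * f (τ₁, n₁) * g (τ - τ₁, n - n₁) /
          (jb (τ + (n : ℝ) ^ 2) ^ (3/8 : ℝ) * jb (n₁ : ℝ) ^ (s - 1/2)
            * jb (τ₁ + γ * |(n₁ : ℝ)| * (n₁ : ℝ)) ^ (1/2 : ℝ)
            * jb ((n : ℝ) - (n₁ : ℝ)) ^ s
            * jb (τ - τ₁ + ((n : ℝ) - (n₁ : ℝ)) ^ 2) ^ (1/2 : ℝ))))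
      ≤ ENNReal.ofReal C * l2RZ f * l2RZ g * l2RZ h := by
  obtain ⟨D, hD, hres⟩ := resonance γ hγ1
  obtain ⟨M1, hM1, hb1⟩ := K1_bound γ hγ1
  obtain ⟨M2, hM2, hb2⟩ := K2_bound γ hγ1
  obtain ⟨M3, hM3, hb3⟩ := K3_bound
  set E : ℝ≥0∞ := M1 ^ (1/2 : ℝ) + M2 ^ (1/2 : ℝ) + M3 ^ (1/2 : ℝ) with hE
  have hEf : E ≠ ⊤ := by
    have := ENNReal.rpow_ne_top_of_nonneg (show (0:ℝ) ≤ 1/2 by norm_num) hM1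
    have := ENNReal.rpow_ne_top_of_nonneg (show (0:ℝ) ≤ 1/2 by norm_num) hM2
    have := ENNReal.rpow_ne_top_of_nonneg (show (0:ℝ) ≤ 1/2 by norm_num) hM3
    rw [hE]; finiteness
  refine ⟨D ^ (1/2 : ℝ) * (E.toReal + 1), by positivity, ?_⟩
  intro f g h hf hg hh hf0 hg0 hh0 _ _ _
  set f' : ℝ × ℤ → ℝ≥0∞ := fun p => ENNReal.ofReal (f p) with hf'
  set g' : ℝ × ℤ → ℝ≥0∞ := fun p => ENNReal.ofReal (g p) with hg'
  set h' : ℝ × ℤ → ℝ≥0∞ := fun p => ENNReal.ofReal (h p) with hh'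
  have mf : Measurable f' := hf.ennreal_ofReal
  have mg : Measurable g' := hg.ennreal_ofReal
  have mh : Measurable h' := hh.ennreal_ofReal
  set T : (ℝ × ℤ) → (ℝ × ℤ) → ℝ≥0∞ := fun p q =>
    h' p * f' q * g' (p - q) * K1 γ p q + h' p * f' q * g' (p - q) * K2 γ p q
      + h' p * f' q * g' (p - q) * K3 p q with hT
  have mB : Measurable fun z : (ℝ × ℤ) × (ℝ × ℤ) => h' z.1 * f' z.2 * g' (z.1 - z.2) :=
    ((mh.comp measurable_fst).mul (mf.comp measurable_snd)).mul
      (mg.comp (measurable_fst.sub measurable_snd))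
  have mT1 : Measurable fun z : (ℝ × ℤ) × (ℝ × ℤ) =>
    h' z.1 * f' z.2 * g' (z.1 - z.2) * K1 γ z.1 z.2 := mB.mul (K1_meas γ)
  have mT2 : Measurable fun z : (ℝ × ℤ) × (ℝ × ℤ) =>
    h' z.1 * f' z.2 * g' (z.1 - z.2) * K2 γ z.1 z.2 := mB.mul (K2_meas γ)
  have mT3 : Measurable fun z : (ℝ × ℤ) × (ℝ × ℤ) =>
    h' z.1 * f' z.2 * g' (z.1 - z.2) * K3 z.1 z.2 := mB.mul K3_meas
  have mT : Measurable fun z : (ℝ × ℤ) × (ℝ × ℤ) => T z.1 z.2 := (mT1.add mT2).add mT3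
  have ptw : ∀ (n n₁ : ℤ) (τ τ₁ : ℝ), ENNReal.ofReal (
          jb (n : ℝ) ^ s * h (τ, n) * f (τ₁, n₁) * g (τ - τ₁, n - n₁) /
          (jb (τ + (n : ℝ) ^ 2) ^ (3/8 : ℝ) * jb (n₁ : ℝ) ^ (s - 1/2)
            * jb (τ₁ + γ * |(n₁ : ℝ)| * (n₁ : ℝ)) ^ (1/2 : ℝ)
            * jb ((n : ℝ) - (n₁ : ℝ)) ^ s
            * jb (τ - τ₁ + ((n : ℝ) - (n₁ : ℝ)) ^ 2) ^ (1/2 : ℝ)))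
      ≤ ENNReal.ofReal (D ^ (1/2 : ℝ)) * T (τ, n) (τ₁, n₁) := by
    intro n n₁ τ τ₁
    have hp := real_ptw hs hD (jb_pos (n : ℝ)) (jb_pos (n₁ : ℝ)) (jb_pos ((n : ℝ) - n₁))
      (jb_pos (τ + (n : ℝ) ^ 2)) (jb_pos (τ₁ + γ * |(n₁ : ℝ)| * (n₁ : ℝ)))
      (jb_pos (τ - τ₁ + ((n : ℝ) - (n₁ : ℝ)) ^ 2))
      (by have := jb_add_le (n₁ : ℝ) ((n : ℝ) - n₁); simpa using this)
      (hres n n₁ τ τ₁)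
    have eG : Gw ((τ, n) - (τ₁, n₁)) = jb (τ - τ₁ + ((n : ℝ) - (n₁ : ℝ)) ^ 2) := by
      simp [Gw]
    have q1 := jb_pos (τ + (n : ℝ) ^ 2)
    have q2 := jb_pos (τ₁ + γ * |(n₁ : ℝ)| * (n₁ : ℝ))
    have q3 := jb_pos (τ - τ₁ + ((n : ℝ) - (n₁ : ℝ)) ^ 2)
    have q4 := jb_pos ((n : ℝ) - n₁)
    have r1 := hh0 (τ, n)
    have r2 := hf0 (τ₁, n₁)
    have r3 := hg0 (τ - τ₁, n - n₁)
    simp only [hT, K1, K2, K3, eG, hf', hg', hh', Fw, ← mul_add]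
    simp only [Gw]
    rw [← ENNReal.ofReal_add (by positivity) (by positivity),
      ← ENNReal.ofReal_add (by positivity) (by positivity), Prod.mk_sub_mk,
      ← ENNReal.ofReal_mul r1, ← ENNReal.ofReal_mul (by positivity),
      ← ENNReal.ofReal_mul (by positivity), ← ENNReal.ofReal_mul (by positivity)]
    refine ENNReal.ofReal_le_ofReal ?_
    refine le_trans (le_of_eq ?_) ((mul_le_mul_of_nonneg_left hp
      (mul_nonneg (mul_nonneg r1 r2) r3)).trans (le_of_eq ?_))
    · ring
    · ring
  calc _ ≤ ∑' n : ℤ, ∑' n₁ : ℤ, ∫⁻ τ : ℝ, ∫⁻ τ₁ : ℝ,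
          ENNReal.ofReal (D ^ (1/2 : ℝ)) * T (τ, n) (τ₁, n₁) :=
        ENNReal.tsum_le_tsum fun n => ENNReal.tsum_le_tsum fun n₁ =>
          lintegral_mono fun τ => lintegral_mono fun τ₁ => ptw n n₁ τ τ₁
    _ = ENNReal.ofReal (D ^ (1/2 : ℝ)) * ∑' n : ℤ, ∑' n₁ : ℤ, ∫⁻ τ : ℝ, ∫⁻ τ₁ : ℝ,
          T (τ, n) (τ₁, n₁) := by
        simp_rw [lintegral_const_mul' _ _ ENNReal.ofReal_ne_top, ENNReal.tsum_mul_left]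
    _ = ENNReal.ofReal (D ^ (1/2 : ℝ)) * ∫⁻ p, ∫⁻ q, T p q ∂PP ∂PP := by
        rw [unfold_sum T mT]
    _ ≤ ENNReal.ofReal (D ^ (1/2 : ℝ)) * (E * (l2RZ f * l2RZ g * l2RZ h)) := by
        gcongr
        have e : ∫⁻ p, ∫⁻ q, T p q ∂PP ∂PP =
            ∫⁻ p, ∫⁻ q, h' p * f' q * g' (p - q) * K1 γ p q ∂PP ∂PP
            + ∫⁻ p, ∫⁻ q, h' p * f' q * g' (p - q) * K2 γ p q ∂PP ∂PP
            + ∫⁻ p, ∫⁻ q, h' p * f' q * g' (p - q) * K3 p q ∂PP ∂PP := by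
          rw [hT, split_int (fun p q => h' p * f' q * g' (p - q) * K1 γ p q
            + h' p * f' q * g' (p - q) * K2 γ p q) _ (mT1.add mT2),
            split_int (fun p q => h' p * f' q * g' (p - q) * K1 γ p q) _ mT1]
        rw [e, hE, add_mul, add_mul, l2RZ_eq f hf, l2RZ_eq g hg, l2RZ_eq h hh]
        exact add_le_add (add_le_add (tri1 mf mg mh (K1_meas γ) hb1)
          (tri2 mf mg mh (K2_meas γ) hb2)) (tri3 mf mg mh K3_meas hb3)
    _ ≤ _ := by
        rw [ENNReal.ofReal_mul (by positivity)]
        have : E ≤ ENNReal.ofReal (E.toReal + 1) := by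
          rw [← ENNReal.ofReal_toReal hEf]
          refine ENNReal.ofReal_le_ofReal ?_
          rw [ENNReal.toReal_ofReal ENNReal.toReal_nonneg]; linarith
        calc _ ≤ ENNReal.ofReal (D ^ (1/2 : ℝ)) *
              (ENNReal.ofReal (E.toReal + 1) * (l2RZ f * l2RZ g * l2RZ h)) := by gcongr
          _ = _ := by ring
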